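/- Let G be a finite connected simple graph with at least one vertex. Then the set {τ_G(v) : v ∈ V(G)} of detour orders of vertices of G has at most ⌈τ(G)/2⌉ elements. -/

import Mathlib

open SimpleGraph

/-- The detour order of a vertex `v`: the maximum number of vertices of a path
in `G` having `v` as an endvertex. -/
noncomputable def vertexDetourOrder {V : Type*} (G : SimpleGraph V) (v : V) : ℕ :=
  sSup {n | ∃ (w : V) (p : G.Walk v w), p.IsPath ∧ n = p.length + 1}

/-- The detour order of `G`: the maximum number of vertices of a path in `G`. -/
noncomputable def detourOrder {V : Type*} (G : SimpleGraph V) : ℕ :=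
  sSup {n | ∃ (u w : V) (p : G.Walk u w), p.IsPath ∧ n = p.length + 1}

/-- A graph is traceable if it has a hamiltonian path, i.e. a path through all vertices. -/
def Traceable {V : Type*} (G : SimpleGraph V) : Prop :=
  ∃ (u w : V) (p : G.Walk u w), p.IsPath ∧ ∀ x, x ∈ p.support

theorem aux_first {V : Type*} (G : SimpleGraph V) (S : Set V) {v u : V} (r : G.Walk v u) :
    u ∈ S → ∃ (y : V) (q : G.Walk v y), y ∈ S ∧ ∀ z ∈ q.support, z ∈ S → z = y := by
  induction r with
  | nil => intro h; exact ⟨_, SimpleGraph.Walk.nil, h, by simp⟩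
  | @cons a b c h r ih =>
    intro hu
    by_cases ha : a ∈ S
    · exact ⟨a, SimpleGraph.Walk.nil, ha, by simp⟩
    · obtain ⟨y, q, hy, hq⟩ := ih hu
      refine ⟨y, SimpleGraph.Walk.cons h q, hy, ?_⟩
      intro z hz hzS
      rw [SimpleGraph.Walk.support_cons, List.mem_cons] at hz
      rcases hz with rfl | hz
      · exact absurd hzS ha
      · exact hq z hz hzS

theorem aux_append {V : Type*} (G : SimpleGraph V) {v y w : V} (q : G.Walk v y) (s : G.Walk y w)
    (hq : q.IsPath) (hs : s.IsPath) (h : ∀ z ∈ q.support, z ∈ s.support → z = y) :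
    (q.append s).IsPath := by
  rw [SimpleGraph.Walk.isPath_def, SimpleGraph.Walk.support_append, List.nodup_append']
  have hn := hs.support_nodup
  rw [SimpleGraph.Walk.support_eq_cons, List.nodup_cons] at hn
  refine ⟨hq.support_nodup, hn.2, ?_⟩
  intro z hz hz'
  have := h z hz (List.mem_of_mem_tail hz')
  subst this
  exact hn.1 hz'

theorem aux_le {V : Type*} [Fintype V] (G : SimpleGraph V) {v w : V} (p : G.Walk v w)
    (hp : p.IsPath) : p.length + 1 ≤ vertexDetourOrder G v := by
  apply le_csSup
  · refine ⟨Fintype.card V, ?_⟩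
    rintro n ⟨w, p, hp, rfl⟩
    exact hp.length_lt
  · exact ⟨w, p, hp, rfl⟩

theorem aux_bdd {V : Type*} [Fintype V] (G : SimpleGraph V) :
    BddAbove {n | ∃ (u w : V) (p : G.Walk u w), p.IsPath ∧ n = p.length + 1} := by
  refine ⟨Fintype.card V, ?_⟩
  rintro n ⟨u, w, p, hp, rfl⟩
  exact hp.length_lt

theorem aux_lower {V : Type*} [Fintype V] (G : SimpleGraph V) (hG : G.Connected) (v : V) :
    detourOrder G / 2 + 1 ≤ vertexDetourOrder G v := by
  classical
  obtain ⟨u, w, p, hp, hn⟩ := Nat.sSup_mem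
    (s := {n | ∃ (u w : V) (p : G.Walk u w), p.IsPath ∧ n = p.length + 1})
    ⟨1, v, v, SimpleGraph.Walk.nil, by simp, by simp⟩ (aux_bdd G)
  change detourOrder G = _ at hn
  obtain ⟨r⟩ := hG.preconnected v u
  obtain ⟨y, q, hy, hq⟩ := aux_first G {z | z ∈ p.support} r (by simp)
  change y ∈ p.support at hy
  have hq' : ∀ z ∈ q.bypass.support, z ∈ p.support → z = y :=
    fun z hz hz' => hq z (q.support_bypass_subset hz) hz'
  have hl : (p.takeUntil y hy).length + (p.dropUntil y hy).length = p.length := by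
    rw [← SimpleGraph.Walk.length_append, SimpleGraph.Walk.take_spec]
  have h1 := aux_le G _ (aux_append G q.bypass (p.dropUntil y hy) q.bypass_isPath
    (hp.dropUntil hy) (fun z hz hz' => hq' z hz (p.support_dropUntil_subset hy hz')))
  have h2 := aux_le G _ (aux_append G q.bypass (p.takeUntil y hy).reverse q.bypass_isPath
    (hp.takeUntil hy).reverse (fun z hz hz' => hq' z hz (p.support_takeUntil_subset hy
      (by simpa using hz'))))
  have h3 : q.bypass.length + (p.takeUntil y hy).length + 1 ≤ vertexDetourOrder G v := by
    simpa using h2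
  rw [SimpleGraph.Walk.length_append] at h1
  omega

theorem aux_upper {V : Type*} [Fintype V] (G : SimpleGraph V) (v : V) :
    vertexDetourOrder G v ≤ detourOrder G := by
  refine csSup_le_csSup (aux_bdd G) ⟨1, v, SimpleGraph.Walk.nil, by simp, by simp⟩ ?_
  rintro n ⟨w, p, hp, rfl⟩
  exact ⟨v, w, p, hp, rfl⟩

theorem stmt_1 {V : Type*} [Fintype V] (G : SimpleGraph V) (hG : G.Connected) :
    (Set.range (vertexDetourOrder G)).ncard ≤ (detourOrder G + 1) / 2 := by
  have h : Set.range (vertexDetourOrder G) ⊆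
      ((Finset.Icc (detourOrder G / 2 + 1) (detourOrder G) : Finset ℕ) : Set ℕ) := by
    rintro _ ⟨v, rfl⟩
    simp only [Finset.coe_Icc, Set.mem_Icc]
    exact ⟨aux_lower G hG v, aux_upper G v⟩
  have h2 := Set.ncard_le_ncard h (Finset.finite_toSet _)
  rw [Set.ncard_coe_finset, Nat.card_Icc] at h2
  omega
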